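/- For the symmetric random walk whose starting point X_0 is chosen uniformly at random from T_N = {0,1,…,N}, the scaled range R_N/N converges in distribution to the uniform distribution on [0,1]: for every β ∈ (0,1), lim_{N→∞} P(R_N ≥ βN) = 1 − β. -/

import Mathlib

open Filter Topology

/-- Position of the nearest-neighbor walk after the steps `w` (`true` = one step right,
`false` = one step left), started from `x`. -/
def walkPos (x : ℤ) (w : List Bool) : ℤ :=
  x + (w.count true : ℤ) - (w.count false : ℤ)

/-- `w` is the step sequence of a trajectory on `{0, 1, …, N}` started at `x` and run
exactly until the exit time `τ_N = T_0 ∧ T_N`: all positions strictly before the last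
step lie strictly inside `(0, N)`, and the final position is `0` or `N`. -/
def IsExitPath (N : ℕ) (x : ℤ) (w : List Bool) : Prop :=
  (∀ k < w.length, 0 < walkPos x (w.take k) ∧ walkPos x (w.take k) < (N : ℤ)) ∧
    (walkPos x w = 0 ∨ walkPos x w = (N : ℤ))

/-- Probability weight of the step sequence `w` when each step goes right with
probability `p` and left with probability `1 - p`, independently. -/
noncomputable def wt (p : ℝ) (w : List Bool) : ℝ :=
  p ^ w.count true * (1 - p) ^ w.count false

/-- `prob N p x S` is the probability, for the walk on `{0, …, N}` with right-step
probability `p` started at `x` and stopped at the exit time `τ_N`, that its stopped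
trajectory (recorded as the step sequence up to time `τ_N`) satisfies `S`. -/
noncomputable def prob (N : ℕ) (p : ℝ) (x : ℤ) (S : List Bool → Prop) : ℝ :=
  ∑' w : List Bool, Set.indicator {w | IsExitPath N x w ∧ S w} (wt p) w

/-- Expectation of `f` of the stopped trajectory for the walk started at `x`. -/
noncomputable def expect (N : ℕ) (p : ℝ) (x : ℤ) (f : List Bool → ℝ) : ℝ :=
  ∑' w : List Bool, Set.indicator {w | IsExitPath N x w} (fun w => wt p w * f w) w

/-- Probability for the walk whose starting point is uniformly distributed on
`{0, 1, …, N}`; the event `S` may depend on the starting point. -/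
noncomputable def probUniform (N : ℕ) (p : ℝ) (S : ℤ → List Bool → Prop) : ℝ :=
  (∑ x ∈ Finset.range (N + 1), prob N p (x : ℤ) (S (x : ℤ))) / (N + 1)

/-- The set of sites visited by the stopped walk up to time `τ_N` (time `0` included). -/
def rangeSet (x : ℤ) (w : List Bool) : Finset ℤ :=
  (Finset.range (w.length + 1)).image fun k => walkPos x (w.take k)

/-- The range `R_N`: the number of distinct sites visited up to the exit time. -/
def rangeCount (x : ℤ) (w : List Bool) : ℕ := (rangeSet x w).card

/-- The local time `G(y) = Σ_{k=0}^{τ_N} 1_{X_k = y}` of the stopped trajectory `w`. -/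
def localTime (x y : ℤ) (w : List Bool) : ℕ :=
  ((Finset.range (w.length + 1)).filter fun k => walkPos x (w.take k) = y).card

/-- The event `T_y < τ_N`: the walk started at `x` visits `y` at some time
`k ≥ 1` strictly before the end of the stopped trajectory `w`. -/
def hitsBefore (x y : ℤ) (w : List Bool) : Prop :=
  ∃ k, 1 ≤ k ∧ k < w.length ∧ walkPos x (w.take k) = y

/-! ### First-step analysis -/

def stp (b : Bool) : ℤ := if b then 1 else -1

lemma walkPos_nil (x : ℤ) : walkPos x [] = x := by simp [walkPos]

lemma walkPos_cons (x : ℤ) (b : Bool) (w : List Bool) :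
    walkPos x (b :: w) = walkPos (x + stp b) w := by
  cases b <;> simp [walkPos, stp] <;> ring

lemma wt_nil (p : ℝ) : wt p [] = 1 := by simp [wt]

lemma wt_cons (b : Bool) (w : List Bool) : wt (1/2) (b :: w) = 1/2 * wt (1/2) w := by
  cases b <;> simp [wt] <;> ring

lemma wt_nonneg (w : List Bool) : 0 ≤ wt (1/2) w := by
  unfold wt; norm_num

lemma exit_nil (N : ℕ) (x : ℤ) : IsExitPath N x [] ↔ x = 0 ∨ x = N := by
  simp [IsExitPath, walkPos_nil]

lemma exit_cons (N : ℕ) (x : ℤ) (b : Bool) (w : List Bool) :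
    IsExitPath N x (b :: w) ↔ (0 < x ∧ x < N) ∧ IsExitPath N (x + stp b) w := by
  unfold IsExitPath
  rw [walkPos_cons, ← and_assoc]
  refine and_congr_left fun _ => ?_
  constructor
  · intro h
    refine ⟨by simpa [walkPos_nil] using h 0 (by simp), fun k hk => ?_⟩
    have := h (k+1) (by simpa using hk)
    simpa [walkPos_cons] using this
  · rintro ⟨h0, h⟩ k hk
    cases k with
    | zero => simpa [walkPos_nil] using h0
    | succ k =>
      have := h k (by simpa using hk)
      simpa [walkPos_cons] using this

/-- decomposition of lists of booleans -/
def listEquiv : List Bool ≃ Unit ⊕ (List Bool ⊕ List Bool) where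
  toFun w := match w with
    | [] => Sum.inl ()
    | true :: w => Sum.inr (Sum.inl w)
    | false :: w => Sum.inr (Sum.inr w)
  invFun o := match o with
    | Sum.inl () => []
    | Sum.inr (Sum.inl w) => true :: w
    | Sum.inr (Sum.inr w) => false :: w
  left_inv w := by
    match w with
    | [] => rfl
    | true :: w => rfl
    | false :: w => rfl
  right_inv o := by
    match o with
    | Sum.inl () => rfl
    | Sum.inr (Sum.inl w) => rfl
    | Sum.inr (Sum.inr w) => rfl

lemma tsum_list (f : List Bool → ENNReal) :
    ∑' w, f w = f [] + (∑' w, f (true :: w) + ∑' w, f (false :: w)) := by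
  rw [← listEquiv.symm.tsum_eq f, Summable.tsum_sum ENNReal.summable ENNReal.summable,
    Summable.tsum_sum ENNReal.summable ENNReal.summable, tsum_fintype, Fintype.sum_unique]
  rfl

/-- the weight of an exit path in an event, as an extended nonnegative real -/
noncomputable def ew (N : ℕ) (x : ℤ) (S : List Bool → Prop) (w : List Bool) : ENNReal :=
  ENNReal.ofReal (Set.indicator {w | IsExitPath N x w ∧ S w} (wt (1/2)) w)

lemma ew_eq (N : ℕ) (x : ℤ) (S : List Bool → Prop) (w : List Bool) [Decidable (IsExitPath N x w ∧ S w)] :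
    ew N x S w = if IsExitPath N x w ∧ S w then ENNReal.ofReal (wt (1/2) w) else 0 := by
  unfold ew
  by_cases h : IsExitPath N x w ∧ S w <;> simp [Set.indicator, h]

lemma ew_cons (N : ℕ) (x : ℤ) (S : List Bool → Prop) (b : Bool) (w : List Bool)
    (hx : 0 < x ∧ x < N) :
    ew N x S (b :: w) = ENNReal.ofReal (1/2) * ew N (x + stp b) (fun w => S (b :: w)) w := by
  classical
  rw [ew_eq, ew_eq, exit_cons, wt_cons, ENNReal.ofReal_mul (by norm_num)]
  simp [hx]

lemma ew_cons_out (N : ℕ) (x : ℤ) (S : List Bool → Prop) (b : Bool) (w : List Bool)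
    (hx : ¬ (0 < x ∧ x < N)) : ew N x S (b :: w) = 0 := by
  classical
  rw [ew_eq, exit_cons]
  simp [hx]

lemma ew_nil_le (N : ℕ) (x : ℤ) (S : List Bool → Prop) : ew N x S [] ≤ 1 := by
  classical
  rw [ew_eq, wt_nil]
  split_ifs <;> simp

lemma ew_nil_in (N : ℕ) (x : ℤ) (S : List Bool → Prop) (hx : 0 < x ∧ x < N) :
    ew N x S [] = 0 := by
  classical
  rw [ew_eq, exit_nil, if_neg]
  omega

lemma tsum_ew_out (N : ℕ) (x : ℤ) (S : List Bool → Prop) (hx : ¬ (0 < x ∧ x < N)) :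
    ∑' w, ew N x S w = ew N x S [] := by
  rw [tsum_list]; simp [ew_cons_out _ _ _ _ _ hx]

lemma tsum_ew_in (N : ℕ) (x : ℤ) (S : List Bool → Prop) (hx : 0 < x ∧ x < N) :
    ∑' w, ew N x S w = ENNReal.ofReal (1/2) * ∑' w, ew N (x+1) (fun w => S (true :: w)) w
      + ENNReal.ofReal (1/2) * ∑' w, ew N (x-1) (fun w => S (false :: w)) w := by
  rw [tsum_list, ew_nil_in _ _ _ hx]
  simp only [ew_cons _ _ _ _ _ hx, ENNReal.tsum_mul_left, zero_add]
  rfl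

lemma half_add_half : ENNReal.ofReal (1/2) + ENNReal.ofReal (1/2) = 1 := by
  rw [← ENNReal.ofReal_add (by norm_num) (by norm_num)]; norm_num

lemma tsum_ew_short (N : ℕ) (n : ℕ) : ∀ (x : ℤ) (S : List Bool → Prop),
    (∀ w, S w → w.length < n) → ∑' w, ew N x S w ≤ 1 := by
  induction n with
  | zero =>
    intro x S hS
    classical
    have : ∀ w, ew N x S w = 0 := fun w => by
      rw [ew_eq, if_neg]
      rintro ⟨_, h⟩
      simpa using hS w h
    simp [this]
  | succ n ih =>
    intro x S hS
    by_cases hx : 0 < x ∧ x < N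
    · rw [tsum_ew_in _ _ _ hx]
      calc _ ≤ ENNReal.ofReal (1/2) * 1 + ENNReal.ofReal (1/2) * 1 := by
            gcongr
            · exact ih _ _ fun w hw => by simpa using hS _ hw
            · exact ih _ _ fun w hw => by simpa using hS _ hw
        _ = 1 := by rw [mul_one, half_add_half]
    · rw [tsum_ew_out _ _ _ hx]; exact ew_nil_le _ _ _

lemma tsum_ew_le (N : ℕ) (x : ℤ) (S : List Bool → Prop) : ∑' w, ew N x S w ≤ 1 := by
  classical
  rw [ENNReal.tsum_eq_iSup_sum]
  refine iSup_le fun u => ?_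
  let n := u.sup List.length + 1
  refine le_trans ?_ (tsum_ew_short N n x (fun w => S w ∧ w.length < n) fun w h => h.2)
  refine le_trans (Finset.sum_le_sum fun w hw => ?_) (ENNReal.sum_le_tsum u)
  have : w.length < n := Nat.lt_succ_of_le (Finset.le_sup (f := List.length) hw)
  rw [ew_eq, ew_eq]
  simp [this]

lemma prob_eq (N : ℕ) (x : ℤ) (S : List Bool → Prop) :
    prob N (1/2) x S = (∑' w, ew N x S w).toReal := by
  rw [ENNReal.tsum_toReal_eq (fun w => by simp [ew])]
  unfold prob ew
  congr 1; ext w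
  rw [ENNReal.toReal_ofReal]
  exact Set.indicator_nonneg (fun w _ => wt_nonneg w) w

lemma tsum_ne_top (N : ℕ) (x : ℤ) (S : List Bool → Prop) : ∑' w, ew N x S w ≠ ⊤ :=
  ne_top_of_le_ne_top ENNReal.one_ne_top (tsum_ew_le N x S)

lemma prob_step (N : ℕ) (x : ℤ) (S : List Bool → Prop) (hx : 0 < x ∧ x < N) :
    prob N (1/2) x S = 1/2 * prob N (1/2) (x+1) (fun w => S (true :: w))
      + 1/2 * prob N (1/2) (x-1) (fun w => S (false :: w)) := by
  rw [prob_eq, prob_eq, prob_eq, tsum_ew_in _ _ _ hx,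
    ENNReal.toReal_add (ENNReal.mul_ne_top (by simp) (tsum_ne_top _ _ _))
      (ENNReal.mul_ne_top (by simp) (tsum_ne_top _ _ _)), ENNReal.toReal_mul, ENNReal.toReal_mul,
    ENNReal.toReal_ofReal (by norm_num)]

lemma prob_bdry_one (N : ℕ) (x : ℤ) (S : List Bool → Prop) (hx : x = 0 ∨ x = N) (h : S []) :
    prob N (1/2) x S = 1 := by
  classical
  rw [prob_eq, tsum_ew_out _ _ _ (by omega), ew_eq, if_pos ⟨(exit_nil _ _).2 hx, h⟩, wt_nil]
  simp

lemma prob_bdry_zero (N : ℕ) (x : ℤ) (S : List Bool → Prop) (hx : x = 0 ∨ x = N) (h : ¬ S []) :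
    prob N (1/2) x S = 0 := by
  classical
  rw [prob_eq, tsum_ew_out _ _ _ (by omega), ew_eq, if_neg (fun h' => h h'.2)]
  simp

lemma prob_congr (N : ℕ) (x : ℤ) (S S' : List Bool → Prop)
    (h : ∀ w, IsExitPath N x w → (S w ↔ S' w)) : prob N (1/2) x S = prob N (1/2) x S' := by
  unfold prob
  have : {w | IsExitPath N x w ∧ S w} = {w | IsExitPath N x w ∧ S' w} := by
    ext w; exact and_congr_right (h w)
  rw [this]

lemma prob_or (N : ℕ) (x : ℤ) (S S' : List Bool → Prop) (h : ∀ w, S w → ¬ S' w) :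
    prob N (1/2) x (fun w => S w ∨ S' w) = prob N (1/2) x S + prob N (1/2) x S' := by
  classical
  rw [prob_eq, prob_eq, prob_eq, ← ENNReal.toReal_add (tsum_ne_top _ _ _) (tsum_ne_top _ _ _),
    ← ENNReal.tsum_add]
  congr 2; ext w
  rw [ew_eq, ew_eq, ew_eq]
  have := h w
  by_cases h1 : S w
  · simp [h1, this h1]
  · simp [h1]

/-! ### The range of a path -/

lemma mem_rangeSet (x y : ℤ) (w : List Bool) :
    y ∈ rangeSet x w ↔ ∃ k ≤ w.length, walkPos x (w.take k) = y := by
  simp [rangeSet]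

lemma mem_range_nil (x y : ℤ) : y ∈ rangeSet x [] ↔ y = x := by
  rw [mem_rangeSet]; simp [walkPos_nil, eq_comm]

lemma mem_range_cons (x y : ℤ) (b : Bool) (w : List Bool) :
    y ∈ rangeSet x (b :: w) ↔ y = x ∨ y ∈ rangeSet (x + stp b) w := by
  rw [mem_rangeSet, mem_rangeSet]
  constructor
  · rintro ⟨k, hk, h⟩
    cases k with
    | zero => left; simpa [walkPos_nil, eq_comm] using h
    | succ k =>
      right
      exact ⟨k, by simpa using hk, by simpa [walkPos_cons] using h⟩
  · rintro (h | ⟨k, hk, h⟩)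
    · exact ⟨0, by simp, by simp [walkPos_nil, h]⟩
    · exact ⟨k+1, by simpa using hk, by simpa [walkPos_cons] using h⟩

lemma start_mem (x : ℤ) (w : List Bool) : x ∈ rangeSet x w :=
  (mem_rangeSet _ _ _).2 ⟨0, by simp, by simp [walkPos_nil]⟩

lemma end_mem (x : ℤ) (w : List Bool) : walkPos x w ∈ rangeSet x w :=
  (mem_rangeSet _ _ _).2 ⟨w.length, le_rfl, by simp⟩

lemma range_ivt (w : List Bool) : ∀ (x y z : ℤ), z ∈ rangeSet x w →
    (z ≤ y ∧ y ≤ walkPos x w ∨ walkPos x w ≤ y ∧ y ≤ z) → y ∈ rangeSet x w := by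
  induction w with
  | nil =>
    intro x y z hz h
    rw [mem_range_nil] at *
    rw [walkPos_nil] at h
    omega
  | cons b w ih =>
    intro x y z hz h
    rw [mem_range_cons] at *
    rw [walkPos_cons] at h
    rcases hz with rfl | hz
    · by_cases hy : y = z
      · exact Or.inl hy
      · right
        refine ih _ y _ (start_mem _ _) ?_
        cases b <;> simp only [stp] at * <;> simp at * <;> omega
    · exact Or.inr (ih _ _ _ hz h)

lemma exit_bounds (N : ℕ) (x : ℤ) (w : List Bool) (h : IsExitPath N x w) (z : ℤ)
    (hz : z ∈ rangeSet x w) : 0 ≤ z ∧ z ≤ N := by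
  obtain ⟨k, hk, rfl⟩ := (mem_rangeSet _ _ _).1 hz
  rcases hk.lt_or_eq with hk | rfl
  · have := h.1 k hk
    omega
  · rw [List.take_length]
    have := h.2
    omega

/-- the path ends at `e` and visits `y` -/
def EV (e y : ℤ) (x : ℤ) (w : List Bool) : Prop := walkPos x w = e ∧ y ∈ rangeSet x w

lemma range_iff (N m : ℕ) (hm : 1 ≤ m) (hmN : m < N) (x : ℤ) (w : List Bool)
    (h : IsExitPath N x w) :
    m + 1 ≤ rangeCount x w ↔ (EV 0 m x w ∨ EV N (N - m) x w) := by
  have hb := exit_bounds N x w h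
  have he := end_mem x w
  unfold rangeCount EV
  rcases h.2 with h0 | h0
  · rw [h0]
    have : ¬ ((0:ℤ) = N) := by omega
    simp only [this, false_and, or_false, true_and]
    constructor
    · intro hc
      by_contra hn
      have hsub : rangeSet x w ⊆ Finset.Ico 0 (m:ℤ) := by
        intro z hz
        rw [Finset.mem_Ico]
        refine ⟨(hb z hz).1, ?_⟩
        by_contra hzm
        exact hn (range_ivt w x m z hz (by omega))
      have := Finset.card_le_card hsub
      simp at this
      omega
    · intro hmem
      have hsub : Finset.Icc 0 (m:ℤ) ⊆ rangeSet x w := by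
        intro z hz
        rw [Finset.mem_Icc] at hz
        exact range_ivt w x z m hmem (by omega)
      have := Finset.card_le_card hsub
      simp at this
      omega
  · rw [h0]
    have : ¬ ((N:ℤ) = 0) := by omega
    simp only [this, false_and, false_or, true_and]
    constructor
    · intro hc
      by_contra hn
      have hsub : rangeSet x w ⊆ Finset.Ioc (N - m : ℤ) N := by
        intro z hz
        rw [Finset.mem_Ioc]
        refine ⟨?_, (hb z hz).2⟩
        by_contra hzm
        exact hn (range_ivt w x _ z hz (by omega))
      have := Finset.card_le_card hsub
      simp at this
      omega
    · intro hmem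
      have hsub : Finset.Icc (N - m : ℤ) N ⊆ rangeSet x w := by
        intro z hz
        rw [Finset.mem_Icc] at hz
        exact range_ivt w x z _ hmem (by omega)
      have := Finset.card_le_card hsub
      simp at this
      omega

/-! ### Harmonic functions -/

lemma harm_linear (n : ℕ) (h : ℕ → ℝ)
    (hh : ∀ x, x + 2 ≤ n → h (x+1) = 1/2 * h (x+2) + 1/2 * h x) :
    ∀ x ≤ n, h x = h 0 + x * (h 1 - h 0) := by
  intro x
  induction x using Nat.strong_induction_on with
  | _ x ih =>
    intro hx
    match x with
    | 0 => simp
    | 1 => simp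
    | x + 2 =>
      have h1 := ih (x+1) (by omega) (by omega)
      have h2 := ih x (by omega) (by omega)
      have h3 := hh x hx
      push_cast at *
      linarith

lemma harm_val (n : ℕ) (h : ℕ → ℝ)
    (hh : ∀ x, x + 2 ≤ n → h (x+1) = 1/2 * h (x+2) + 1/2 * h x) (x : ℕ) (hx : x ≤ n) :
    n * h x = n * h 0 + x * (h n - h 0) := by
  rw [harm_linear n h hh x hx, harm_linear n h hh n le_rfl]; ring

lemma harm_sum (n : ℕ) (h : ℕ → ℝ)
    (hh : ∀ x, x + 2 ≤ n → h (x+1) = 1/2 * h (x+2) + 1/2 * h x) :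
    ∑ x ∈ Finset.range (n+1), h x = (n + 1) * (h 0 + h n) / 2 := by
  have key : ∀ k ≤ n, ∑ x ∈ Finset.range (k+1), h x = (k + 1) * (h 0 + h k) / 2 := by
    intro k
    induction k with
    | zero => intro _; simp
    | succ k ih =>
      intro hk
      rw [Finset.sum_range_succ, ih (by omega), harm_linear n h hh (k+1) hk,
        harm_linear n h hh k (by omega)]
      push_cast; ring
  exact key n le_rfl

lemma peak_sum (N y : ℕ) (hy : y ≤ N) (h : ℕ → ℝ)
    (hh : ∀ x, x + 2 ≤ N → x + 1 ≠ y → h (x+1) = 1/2 * h (x+2) + 1/2 * h x)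
    (h0 : h 0 = 0) (hN : h N = 0) :
    ∑ x ∈ Finset.range (N+1), h x = N * h y / 2 := by
  obtain ⟨k, rfl⟩ := Nat.exists_eq_add_of_le hy
  have h1 := harm_sum y h (fun x hx => hh x (by omega) (by omega))
  have h2 := harm_sum k (fun x => h (y + x)) (fun x hx => by
    have := hh (y + x) (by omega) (by omega)
    simpa [add_assoc] using this)
  rw [Finset.sum_range_succ'] at h2
  have e : y + k + 1 = (y + 1) + k := by ring
  rw [e, Finset.sum_range_add, h1]
  have e2 : ∑ x ∈ Finset.range k, h (y + 1 + x) = ∑ x ∈ Finset.range k, h (y + (x + 1)) :=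
    Finset.sum_congr rfl fun x _ => by congr 1; ring
  rw [e2]
  simp only [add_zero, hN, h0] at h2 ⊢
  push_cast
  linarith

/-! ### Exit probabilities -/

lemma exit_harm (N : ℕ) (e : ℤ) (x : ℕ) (hx : x + 2 ≤ N) :
    prob N (1/2) ((x + 1 : ℕ) : ℤ) (fun w => walkPos ((x + 1 : ℕ) : ℤ) w = e) =
      1/2 * prob N (1/2) ((x + 2 : ℕ) : ℤ) (fun w => walkPos ((x + 2 : ℕ) : ℤ) w = e) +
      1/2 * prob N (1/2) (x : ℤ) (fun w => walkPos (x : ℤ) w = e) := by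
  rw [prob_step _ _ _ (by omega)]
  simp only [walkPos_cons, stp]
  have e1 : ((x + 1 : ℕ) : ℤ) + 1 = ((x + 2 : ℕ) : ℤ) := by push_cast; ring
  have e2 : ((x + 1 : ℕ) : ℤ) - 1 = (x : ℤ) := by push_cast; ring
  have e3 : ((x + 1 : ℕ) : ℤ) + -1 = (x : ℤ) := by push_cast; ring
  simp only [if_true, Bool.false_eq_true, if_false, e1, e2, e3]

lemma EV_cons (e y x : ℤ) (b : Bool) (w : List Bool) (h : x ≠ y) :
    EV e y x (b :: w) ↔ EV e y (x + stp b) w := by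
  unfold EV
  rw [walkPos_cons, mem_range_cons]
  simp [h.symm]

lemma EV_harm (N : ℕ) (e y : ℤ) (x : ℕ) (hx : x + 2 ≤ N) (hy : ((x + 1 : ℕ) : ℤ) ≠ y) :
    prob N (1/2) ((x + 1 : ℕ) : ℤ) (EV e y ((x + 1 : ℕ) : ℤ)) =
      1/2 * prob N (1/2) ((x + 2 : ℕ) : ℤ) (EV e y ((x + 2 : ℕ) : ℤ)) +
      1/2 * prob N (1/2) (x : ℤ) (EV e y (x : ℤ)) := by
  rw [prob_step _ _ _ (by omega)]
  simp only [EV_cons e y _ _ _ hy, stp]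
  have e1 : ((x + 1 : ℕ) : ℤ) + 1 = ((x + 2 : ℕ) : ℤ) := by push_cast; ring
  have e2 : ((x + 1 : ℕ) : ℤ) - 1 = (x : ℤ) := by push_cast; ring
  have e3 : ((x + 1 : ℕ) : ℤ) + -1 = (x : ℤ) := by push_cast; ring
  simp only [if_true, Bool.false_eq_true, if_false, e1, e2, e3]

lemma EV_self (N : ℕ) (e y : ℤ) :
    prob N (1/2) y (EV e y y) = prob N (1/2) y (fun w => walkPos y w = e) :=
  prob_congr _ _ _ _ fun w _ => by simp [EV, start_mem]

lemma EV_sum (N y : ℕ) (e : ℤ) (hy : 0 < y) (hyN : y < N) :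
    ∑ x ∈ Finset.range (N+1), prob N (1/2) (x : ℤ) (EV e y (x : ℤ)) =
      N * prob N (1/2) (y : ℤ) (fun w => walkPos (y : ℤ) w = e) / 2 := by
  rw [← EV_self]
  refine peak_sum N y hyN.le (fun x : ℕ => prob N (1/2) (x : ℤ) (EV e y (x : ℤ))) ?_ ?_ ?_
  · intro x hx hxy
    exact EV_harm N e y x hx (by exact_mod_cast hxy)
  · refine prob_bdry_zero _ _ _ (by simp) ?_
    rintro ⟨_, h⟩
    rw [mem_range_nil] at h
    omega
  · refine prob_bdry_zero _ _ _ (by simp) ?_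
    rintro ⟨_, h⟩
    rw [mem_range_nil] at h
    omega

lemma exit_zero (N y : ℕ) (hyN : y < N) :
    N * prob N (1/2) (y : ℤ) (fun w => walkPos (y : ℤ) w = 0) = N - y := by
  have := harm_val N (fun x : ℕ => prob N (1/2) (x : ℤ) (fun w => walkPos (x : ℤ) w = 0))
    (fun x hx => exit_harm N 0 x hx) y hyN.le
  rw [this, prob_bdry_one N _ _ (by simp) (by simp [walkPos_nil]),
    prob_bdry_zero N _ _ (by simp) (by simp [walkPos_nil]; omega)]
  ring

lemma exit_top (N y : ℕ) (hyN : y < N) :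
    N * prob N (1/2) (y : ℤ) (fun w => walkPos (y : ℤ) w = N) = y := by
  have := harm_val N (fun x : ℕ => prob N (1/2) (x : ℤ) (fun w => walkPos (x : ℤ) w = N))
    (fun x hx => exit_harm N N x hx) y hyN.le
  rw [this, prob_bdry_zero N ((0:ℕ):ℤ) _ (by simp) (by simp [walkPos_nil]; omega),
    prob_bdry_one N _ _ (by simp) (by simp [walkPos_nil])]
  ring

lemma probUniform_eq (N m : ℕ) (hm : 1 ≤ m) (hmN : m < N) :
    probUniform N (1/2) (fun x w => m + 1 ≤ rangeCount x w) = ((N : ℝ) - m) / (N + 1) := by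
  unfold probUniform
  congr 1
  have h1 : ∀ x ∈ Finset.range (N+1), prob N (1/2) (x : ℤ) (fun w => m + 1 ≤ rangeCount x w) =
      prob N (1/2) (x : ℤ) (EV 0 m x) + prob N (1/2) (x : ℤ) (EV N ((N - m : ℕ) : ℤ) x) := by
    intro x _
    rw [← prob_or]
    · refine prob_congr _ _ _ _ fun w hw => ?_
      rw [range_iff N m hm hmN x w hw, Nat.cast_sub hmN.le]
    · rintro w ⟨h, _⟩ ⟨h', _⟩
      omega
  rw [Finset.sum_congr rfl h1, Finset.sum_add_distrib, EV_sum N m 0 (by omega) hmN,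
    EV_sum N (N-m) N (by omega) (by omega), exit_zero N m hmN, exit_top N (N-m) (by omega),
    Nat.cast_sub hmN.le]
  ring

/-- Proposition 2 (symmetric case): for the symmetric walk started uniformly at random
on `{0, …, N}`, `R_N / N` converges in distribution to `U[0,1]`. -/
theorem range_uniform_start_symmetric (β : ℝ) (hβ0 : 0 < β) (hβ1 : β < 1) :
    Tendsto (fun N : ℕ => probUniform N (1/2)
        fun x w => β * (N : ℝ) ≤ (rangeCount x w : ℝ))
      atTop (𝓝 (1 - β)) := by
  have hlim : Tendsto (fun N : ℕ => ((N : ℝ) - ((⌈β * N⌉₊ : ℝ) - 1)) / (N + 1)) atTop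
      (𝓝 (1 - β)) := by
    have a1 : Tendsto (fun N : ℕ => (⌈β * N⌉₊ : ℝ) / N) atTop (𝓝 β) :=
      (tendsto_nat_ceil_mul_div_atTop hβ0.le).comp tendsto_natCast_atTop_atTop
    have a2 : Tendsto (fun N : ℕ => (N : ℝ) / (N + 1)) atTop (𝓝 1) :=
      tendsto_natCast_div_add_atTop 1
    have a3 : Tendsto (fun N : ℕ => 1 / ((N : ℝ) + 1)) atTop (𝓝 0) :=
      tendsto_one_div_add_atTop_nhds_zero_nat
    have a4 := (((tendsto_const_nhds (x := (1:ℝ))).sub a1).mul a2).add a3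
    rw [mul_one, add_zero] at a4
    refine a4.congr' ?_
    filter_upwards [eventually_gt_atTop 0] with N hN
    have : (0:ℝ) < N := by exact_mod_cast hN
    field_simp
    ring
  refine hlim.congr' ?_
  have hev : ∀ᶠ N : ℕ in atTop, 1 < β * (N : ℝ) :=
    (tendsto_natCast_atTop_atTop.const_mul_atTop hβ0).eventually_gt_atTop 1
  filter_upwards [hev, eventually_gt_atTop 0] with N h1 hN
  have hr2 : 1 < ⌈β * (N:ℝ)⌉₊ := Nat.lt_ceil.2 (by exact_mod_cast h1)
  have hrN : ⌈β * (N:ℝ)⌉₊ ≤ N := Nat.ceil_le.2 (by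
    have : (0:ℝ) ≤ N := by positivity
    nlinarith)
  obtain ⟨m, hm⟩ : ∃ m, ⌈β * (N:ℝ)⌉₊ = m + 1 := ⟨⌈β * (N:ℝ)⌉₊ - 1, by omega⟩
  have := probUniform_eq N m (by omega) (by omega)
  rw [← hm] at this
  simp only [Nat.ceil_le] at this
  rw [this, hm]
  push_cast
  ring_nf
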